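/- Let |ψ⟩^{ABCR} = (1/√2) Σ_{z∈{0,1}} |z⟩^A |z⟩^C |φ_z⟩^{BR}. Then the mutual informations of the induced cq channels satisfy I(W_P) + I(W_R) = 1, where W_P : x ↦ σ_x^{BC} with |σ_x⟩ = (1/√2) Σ_z (-1)^{xz} |φ_z⟩^{BR}|z⟩^C, and W_R : z ↦ φ_z^R, and I(W) denotes the symmetric Holevo information of a binary-input cq channel W. -/

import Mathlib

open scoped ComplexConjugate

/-- Von Neumann entropy (base 2) of a matrix. -/
noncomputable def vnEntropy {n : Type*} [Fintype n] [DecidableEq n]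
    (ρ : Matrix n n ℂ) : ℝ :=
  if h : ρ.IsHermitian then -∑ i, h.eigenvalues i * Real.logb 2 (h.eigenvalues i) else 0

/-- Symmetric Holevo information of a binary-input cq channel `x ↦ ρ_x`:
`I(W) = H((ρ₀+ρ₁)/2) - (H(ρ₀)+H(ρ₁))/2`. -/
noncomputable def holevoI {n : Type*} [Fintype n] [DecidableEq n]
    (ρ : Fin 2 → Matrix n n ℂ) : ℝ :=
  vnEntropy ((1/2 : ℂ) • (ρ 0 + ρ 1)) - (vnEntropy (ρ 0) + vnEntropy (ρ 1)) / 2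

open Matrix Polynomial in
/-- The entropy of a Hermitian matrix as a sum over the roots of its characteristic polynomial. -/
theorem vnEntropy_eq_sum_roots_charpoly {n : Type*} [Fintype n] [DecidableEq n]
    {ρ : Matrix n n ℂ} (h : ρ.IsHermitian) :
    vnEntropy ρ = -(ρ.charpoly.roots.map fun z : ℂ => z.re * Real.logb 2 z.re).sum := by
  rw [vnEntropy, dif_pos h, h.roots_charpoly_eq_eigenvalues]
  simp

open Matrix Polynomial in
theorem vnEntropy_transpose {n : Type*} [Fintype n] [DecidableEq n]
    {ρ : Matrix n n ℂ} (h : ρ.IsHermitian) : vnEntropy ρᵀ = vnEntropy ρ := by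
  rw [vnEntropy_eq_sum_roots_charpoly h, vnEntropy_eq_sum_roots_charpoly h.transpose,
    charpoly_transpose]

open Matrix Polynomial in
/-- The two products of a pair of rectangular matrices have the same entropy. -/
theorem vnEntropy_mul_comm {m n : Type*} [Fintype m] [DecidableEq m] [Fintype n] [DecidableEq n]
    {A : Matrix m n ℂ} {B : Matrix n m ℂ} (h : (A * B).IsHermitian) (h' : (B * A).IsHermitian) :
    vnEntropy (A * B) = vnEntropy (B * A) := by
  rw [vnEntropy_eq_sum_roots_charpoly h, vnEntropy_eq_sum_roots_charpoly h']
  have key := congrArg (fun p : ℂ[X] => (p.roots.map fun z : ℂ => z.re * Real.logb 2 z.re).sum)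
    (charpoly_mul_comm' A B)
  simp only [roots_mul (mul_ne_zero (pow_ne_zero _ X_ne_zero) (charpoly_monic _).ne_zero),
    roots_X_pow, Multiset.map_add, Multiset.sum_add, Multiset.map_nsmul, Multiset.sum_nsmul,
    Multiset.map_singleton, Multiset.sum_singleton, Complex.zero_re, zero_mul, smul_zero,
    zero_add] at key
  rw [key]

open Matrix Polynomial in
theorem Matrix.charpoly_blockDiagonal {R m o : Type*} [CommRing R] [Fintype m] [DecidableEq m]
    [Fintype o] [DecidableEq o] (M : o → Matrix m m R) :
    (blockDiagonal M).charpoly = ∏ k, (M k).charpoly := by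
  have : charmatrix (blockDiagonal M) = blockDiagonal fun k => charmatrix (M k) := by
    ext ⟨i, k⟩ ⟨j, l⟩
    by_cases hkl : k = l <;> by_cases hij : i = j <;>
      simp [blockDiagonal_apply, hkl, hij]
  simp only [charpoly, this, det_blockDiagonal]

open Matrix Polynomial in
/-- Entropy is additive over the blocks of a block diagonal matrix. -/
theorem vnEntropy_blockDiagonal {m o : Type*} [Fintype m] [DecidableEq m] [Fintype o]
    [DecidableEq o] {M : o → Matrix m m ℂ} (h : ∀ k, (M k).IsHermitian) :
    vnEntropy (blockDiagonal M) = ∑ k, vnEntropy (M k) := by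
  have hM : (blockDiagonal M).IsHermitian := by
    rw [Matrix.IsHermitian, blockDiagonal_conjTranspose]
    exact congrArg _ (funext h)
  rw [vnEntropy_eq_sum_roots_charpoly hM, charpoly_blockDiagonal, roots_prod _ _
    (Finset.prod_ne_zero_iff.mpr fun k _ => (charpoly_monic (M k)).ne_zero)]
  simp only [vnEntropy_eq_sum_roots_charpoly (h _), Multiset.map_bind, Multiset.sum_bind,
    Finset.sum_neg_distrib]
  rfl

theorem Matrix.IsHermitian.half_smul {n : Type*} {A : Matrix n n ℂ} (hA : A.IsHermitian) :
    ((1 / 2 : ℂ) • A).IsHermitian := by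
  rw [Matrix.IsHermitian, Matrix.conjTranspose_smul, hA.eq]
  simp

open Matrix Polynomial in
/-- Halving a Hermitian matrix of unit trace halves its entropy and adds half a bit. -/
theorem vnEntropy_half_smul {n : Type*} [Fintype n] [DecidableEq n]
    {ρ : Matrix n n ℂ} (h : ρ.IsHermitian) (htr : ρ.trace = 1) :
    vnEntropy ((1 / 2 : ℂ) • ρ) = vnEntropy ρ / 2 + 1 / 2 := by
  have hcp : ((1 / 2 : ℂ) • ρ).charpoly = ∏ i, (X - C ((1 / 2 : ℂ) * h.eigenvalues i)) := by
    conv_lhs =>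
      rw [h.spectral_theorem, Unitary.conjStarAlgAut_apply, ← Matrix.smul_mul, ← Matrix.mul_smul,
        charpoly_mul_comm, ← mul_assoc]
    simp [← diagonal_smul, charpoly_diagonal]
  have hsum : ∑ i, h.eigenvalues i = 1 := by
    have := congrArg Complex.re (htr.symm.trans h.trace_eq_sum_eigenvalues)
    simpa using this.symm
  have hlog (x : ℝ) : 1 / 2 * x * Real.logb 2 (1 / 2 * x) = x * Real.logb 2 x / 2 - x / 2 := by
    rcases eq_or_ne x 0 with rfl | hx
    · simp
    · rw [Real.logb_mul (by norm_num) hx, one_div, Real.logb_inv,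
        Real.logb_self_eq_one (by norm_num)]
      ring
  have hre (x : ℝ) : ((1 / 2 : ℂ) * x).re = 1 / 2 * x := by simp
  rw [vnEntropy_eq_sum_roots_charpoly h.half_smul, hcp, roots_prod _ _
    (Finset.prod_ne_zero_iff.mpr fun k _ => X_sub_C_ne_zero _), vnEntropy, dif_pos h]
  simp only [roots_X_sub_C, Multiset.bind_singleton, Multiset.map_map, Function.comp_def, hre, hlog]
  change -∑ i, _ = _
  rw [Finset.sum_sub_distrib, ← Finset.sum_div, ← Finset.sum_div, hsum]
  ring

/-- For the state `|ψ⟩^{ABCR} = (1/√2) Σ_{z∈{0,1}} |z⟩^A |z⟩^C |φ_z⟩^{BR}`,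
the symmetric Holevo informations of the phase channel
`W_P : x ↦ σ_x^{BC}` (with `|σ_x⟩ = (1/√2) Σ_z (-1)^{xz} |φ_z⟩^{BR}|z⟩^C`) and
of the reservoir amplitude channel `W_R : z ↦ φ_z^R` satisfy
`I(W_P) + I(W_R) = 1`. -/
theorem phase_reservoir_certainty {B R : Type*}
    [Fintype B] [DecidableEq B] [Fintype R] [DecidableEq R]
    (φ : Fin 2 → B × R → ℂ) (hφ : ∀ z, ∑ i, Complex.normSq (φ z i) = 1) :
    -- output of W_P on input x : the BC marginal of |σ_x⟩
    let WP : Fin 2 → Matrix (B × Fin 2) (B × Fin 2) ℂ := fun x => Matrix.of fun a b =>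
      (1/2 : ℂ) * (-1 : ℂ) ^ (x.val * a.2.val) * (-1 : ℂ) ^ (x.val * b.2.val) *
        ∑ r, φ a.2 (a.1, r) * conj (φ b.2 (b.1, r))
    -- output of W_R on input z : the R marginal of |φ_z⟩
    let WR : Fin 2 → Matrix R R ℂ := fun z => Matrix.of fun r r' =>
      ∑ bb, φ z (bb, r) * conj (φ z (bb, r'))
    holevoI WP + holevoI WR = 1 := by
  intro WP WR
  let Φ : Fin 2 → Matrix B R ℂ := fun z => Matrix.of fun b r => φ z (b, r)
  let N : Fin 2 → Matrix (B × Fin 2) R ℂ := fun x =>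
    Matrix.of fun a r => (-1 : ℂ) ^ (x.val * a.2.val) * φ a.2 (a.1, r)
  have hB (z : Fin 2) : (Φ z * (Φ z).conjTranspose).IsHermitian :=
    Matrix.isHermitian_mul_conjTranspose_self _
  have hR (z : Fin 2) : ((Φ z).conjTranspose * Φ z).IsHermitian :=
    Matrix.isHermitian_conjTranspose_mul_self _
  have htr (z : Fin 2) : (Φ z * (Φ z).conjTranspose).trace = 1 := by
    have := congrArg ((↑) : ℝ → ℂ) (hφ z)
    simpa [Matrix.trace, Matrix.mul_apply, Φ, Complex.mul_conj, Fintype.sum_prod_type] using this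
  have hWR (z : Fin 2) : WR z = ((Φ z).conjTranspose * Φ z).transpose := by
    ext r r'
    simp [WR, Φ, Matrix.mul_apply, mul_comm]
  have hWRherm (z : Fin 2) : (WR z).IsHermitian := hWR z ▸ (hR z).transpose
  have hHR (z : Fin 2) : vnEntropy (WR z) = vnEntropy (Φ z * (Φ z).conjTranspose) := by
    rw [hWR, vnEntropy_transpose (hR z), vnEntropy_mul_comm (hR z) (hB z)]
  have hWP (x : Fin 2) : WP x = ((1 / 2 : ℂ) • N x) * (N x).conjTranspose := by
    ext a b
    simp only [WP, N, Matrix.mul_apply, Matrix.of_apply, Matrix.smul_apply,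
      Matrix.conjTranspose_apply, smul_eq_mul, Finset.mul_sum]
    refine Finset.sum_congr rfl fun r _ => ?_
    simp
    ring
  have hNN (x : Fin 2) : (N x).conjTranspose * ((1 / 2 : ℂ) • N x) =
      ((1 / 2 : ℂ) • (WR 0 + WR 1)).transpose := by
    ext r r'
    fin_cases x <;>
      simp [WR, N, Matrix.mul_apply, Fintype.sum_prod_type, Finset.sum_add_distrib,
        Finset.mul_sum, mul_assoc, mul_comm, mul_left_comm]
  have hHP (x : Fin 2) : vnEntropy (WP x) = vnEntropy ((1 / 2 : ℂ) • (WR 0 + WR 1)) := by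
    have hav := ((hWRherm 0).add (hWRherm 1)).half_smul
    rw [hWP, vnEntropy_mul_comm, hNN, vnEntropy_transpose hav]
    · rw [Matrix.smul_mul]
      exact (Matrix.isHermitian_mul_conjTranspose_self _).half_smul
    · rw [hNN]
      exact hav.transpose
  have hav : (1 / 2 : ℂ) • (WP 0 + WP 1) =
      Matrix.blockDiagonal fun z => (1 / 2 : ℂ) • (Φ z * (Φ z).conjTranspose) := by
    ext ⟨b, z⟩ ⟨b', z'⟩
    fin_cases z <;> fin_cases z' <;>
      simp [WP, Φ, Matrix.mul_apply, Matrix.blockDiagonal_apply] <;> ring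
  have hHav : vnEntropy ((1 / 2 : ℂ) • (WP 0 + WP 1)) =
      1 + (vnEntropy (WR 0) + vnEntropy (WR 1)) / 2 := by
    rw [hav, vnEntropy_blockDiagonal fun z => (hB z).half_smul, Fin.sum_univ_two,
      vnEntropy_half_smul (hB 0) (htr 0), vnEntropy_half_smul (hB 1) (htr 1), hHR, hHR]
    ring
  rw [holevoI, holevoI, hHav, hHP, hHP]
  ring
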